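/- The following are equivalent for a ring R: (1) every coneat exact sequence of left R-modules splits; (2) every left R-module is coneat injective; (3) every left R-module is coneat quasi injective; (4) every left R-module is quasi coneat injective. Furthermore, R is semisimple artinian if and only if R is a right SF-ring (every simple right R-module is flat) and every coneat exact sequence of left R-modules splits. -/

import Mathlib

/-!
Basic notions from the theory of coneat exact sequences.

A short exact sequence `0 → A → B → C → 0` of left `R`-modules is *coneat exact* if for every
simple right `R`-module `S` the induced map `S ⊗[R] A → S ⊗[R] B` is injective.  Since every
simple right `R`-module is isomorphic to `R ⧸ I` for a maximal right ideal `I` (realized below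
as a left ideal `I : Ideal Rᵐᵒᵖ`), and since `(R ⧸ I) ⊗[R] B ≅ B ⧸ I•B` (as abelian groups,
where `I•B` is the additive subgroup generated by the products `i • b`, `i ∈ I`, `b ∈ B`),
this is equivalent to the elementwise condition `A ∩ I•B ⊆ I•A` for every maximal right
ideal `I`, which is the formulation used here (Mathlib has no tensor product of a right module
with a left module over a noncommutative ring).
-/

universe u v

section Defs

variable (R : Type u) [Ring R]

/-- The additive subgroup of a left `R`-module `B` generated by the products `i • n` with
`i` in a right ideal `I` (realized as a left ideal of `Rᵐᵒᵖ`) and `n ∈ N`. -/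
def rIdealSMul {B : Type v} [AddCommGroup B] [Module R B] (I : Ideal Rᵐᵒᵖ) (N : Set B) :
    AddSubgroup B :=
  AddSubgroup.closure {x : B | ∃ i ∈ I, ∃ n ∈ N, x = MulOpposite.unop i • n}

/-- `A` is a *coneat submodule* of `B` : the sequence `0 → A → B → B ⧸ A → 0` remains exact
after tensoring with every simple right `R`-module, i.e. `A ∩ I•B ⊆ I•A` for every maximal
right ideal `I` of `R`. -/
def IsConeatSubmodule {B : Type v} [AddCommGroup B] [Module R B] (A : Submodule R B) : Prop :=
  ∀ I : Ideal Rᵐᵒᵖ, I.IsMaximal → ∀ a : B, a ∈ A →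
    a ∈ rIdealSMul R I (Set.univ : Set B) → a ∈ rIdealSMul R I (A : Set B)

/-- The short exact sequence `0 → A –f→ B –g→ C → 0` is *coneat exact*. -/
def IsConeatExactSeq {A B C : Type v} [AddCommGroup A] [Module R A] [AddCommGroup B] [Module R B]
    [AddCommGroup C] [Module R C] (f : A →ₗ[R] B) (g : B →ₗ[R] C) : Prop :=
  Function.Injective f ∧ Function.Surjective g ∧ Function.Exact f g ∧
    IsConeatSubmodule R (LinearMap.range f)

/-- A left `R`-module `M` is *coneat injective* if for every coneat submodule `A` of a left
`R`-module `B`, every homomorphism `A → M` extends to `B`. -/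
def IsConeatInjective (M : Type v) [AddCommGroup M] [Module R M] : Prop :=
  ∀ (B : ModuleCat.{v} R) (A : Submodule R B), IsConeatSubmodule R A →
    ∀ f : A →ₗ[R] M, ∃ g : B →ₗ[R] M, g.comp A.subtype = f

/-- `e : M → E` is a *coneat injective envelope* of `M` : `e` is injective, `E` is coneat
injective, every homomorphism from `M` to a coneat injective module factors through `e`, and
every endomorphism `f` of `E` with `f ∘ e = e` is an automorphism. -/
def IsConeatInjectiveEnvelope {M E : Type v} [AddCommGroup M] [Module R M] [AddCommGroup E]
    [Module R E] (e : M →ₗ[R] E) : Prop :=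
  Function.Injective e ∧ IsConeatInjective R E ∧
    (∀ (C : ModuleCat.{v} R), IsConeatInjective R C → ∀ g : M →ₗ[R] C,
      ∃ h : E →ₗ[R] C, h.comp e = g) ∧
    (∀ f : E →ₗ[R] E, f.comp e = e → Function.Bijective f)

/-- `M` is *`N`-coneat injective* if every homomorphism from a coneat submodule of `N`
to `M` extends to `N`. -/
def IsRelConeatInjective (M N : Type v) [AddCommGroup M] [Module R M] [AddCommGroup N]
    [Module R N] : Prop :=
  ∀ K : Submodule R N, IsConeatSubmodule R K →
    ∀ f : K →ₗ[R] M, ∃ g : N →ₗ[R] M, g.comp K.subtype = f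

/-- `M` is *quasi coneat injective* if it is `M`-coneat injective. -/
def IsQuasiConeatInjective (M : Type v) [AddCommGroup M] [Module R M] : Prop :=
  IsRelConeatInjective R M M

/-- `M` is *coneat-`N`-injective* if for (some, equivalently every) coneat injective envelope
`e : M → E`, every homomorphism `f : N → E` satisfies `f (N) ⊆ e (M)`. -/
def IsConeatRelInjective (M N : Type v) [AddCommGroup M] [Module R M] [AddCommGroup N]
    [Module R N] : Prop :=
  ∀ (E : ModuleCat.{v} R) (e : M →ₗ[R] E), IsConeatInjectiveEnvelope R e →
    ∀ f : N →ₗ[R] E, ∀ n : N, f n ∈ LinearMap.range e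

/-- `M` is *coneat quasi injective* if it is coneat-`M`-injective, i.e. fully invariant in its
coneat injective envelope. -/
def IsConeatQuasiInjective (M : Type v) [AddCommGroup M] [Module R M] : Prop :=
  IsConeatRelInjective R M M

/-- `A` is a *pure submodule* of `B` : the sequence `0 → A → B → B ⧸ A → 0` remains exact after
tensoring with every right `R`-module; elementwise (Cohn's criterion): every finite system of
linear equations `aᵢ = ∑ⱼ rᵢⱼ • xⱼ` with constants in `A` which is solvable in `B` is solvable
in `A`. -/
def IsPureSubmodule {B : Type v} [AddCommGroup B] [Module R B] (A : Submodule R B) : Prop :=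
  ∀ (m n : ℕ) (r : Fin m → Fin n → R) (a : Fin m → A),
    (∃ b : Fin n → B, ∀ i, (a i : B) = ∑ j, r i j • b j) →
    ∃ a' : Fin n → A, ∀ i, (a i : B) = ∑ j, r i j • (a' j : B)

/-- The short exact sequence `0 → A –f→ B –g→ C → 0` is *pure exact*. -/
def IsPureExactSeq {A B C : Type v} [AddCommGroup A] [Module R A] [AddCommGroup B] [Module R B]
    [AddCommGroup C] [Module R C] (f : A →ₗ[R] B) (g : B →ₗ[R] C) : Prop :=
  Function.Injective f ∧ Function.Surjective g ∧ Function.Exact f g ∧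
    IsPureSubmodule R (LinearMap.range f)

/-- A left `R`-module `M` is *pure injective* if for every pure submodule `A` of a left
`R`-module `B`, every homomorphism `A → M` extends to `B`. -/
def IsPureInjective (M : Type v) [AddCommGroup M] [Module R M] : Prop :=
  ∀ (B : ModuleCat.{v} R) (A : Submodule R B), IsPureSubmodule R A →
    ∀ f : A →ₗ[R] M, ∃ g : B →ₗ[R] M, g.comp A.subtype = f

/-- A right `R`-module `S` (i.e. a left `Rᵐᵒᵖ`-module) is *flat*, expressed through the
equational criterion (which over any ring is equivalent to `S ⊗[R] —` preserving injections):
every relation `∑ᵢ sᵢ aᵢ = 0` in `S` comes from relations in `R`. -/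
def IsFlatRightModule (S : Type v) [AddCommGroup S] [Module Rᵐᵒᵖ S] : Prop :=
  ∀ (m : ℕ) (a : Fin m → R) (s : Fin m → S),
    (∑ i, MulOpposite.op (a i) • s i) = 0 →
    ∃ (n : ℕ) (b : Fin n → Fin m → R) (t : Fin n → S),
      (∀ i, s i = ∑ j, MulOpposite.op (b j i) • t j) ∧ (∀ j, ∑ i, b j i * a i = 0)

/-- A left `R`-module `C` is *coneat flat* if `C ≅ B ⧸ A` for some coneat submodule `A ≤ B`. -/
def IsConeatFlat (C : Type v) [AddCommGroup C] [Module R C] : Prop :=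
  ∃ (B : ModuleCat.{v} R) (A : Submodule R B),
    IsConeatSubmodule R A ∧ Nonempty ((B ⧸ A) ≃ₗ[R] C)

end Defs

section RIdealSMul

variable {R : Type u} [Ring R] {B C : Type v} [AddCommGroup B] [Module R B]
  [AddCommGroup C] [Module R C] {I : Ideal Rᵐᵒᵖ}

theorem smul_mem_rIdealSMul {N : Set B} {i : Rᵐᵒᵖ} (hi : i ∈ I) {n : B} (hn : n ∈ N) :
    i.unop • n ∈ rIdealSMul R I N :=
  AddSubgroup.subset_closure ⟨i, hi, n, hn, rfl⟩

theorem map_mem_rIdealSMul (f : B →ₗ[R] C) {N : Set B} {N' : Set C} (h : Set.MapsTo f N N')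
    {x : B} (hx : x ∈ rIdealSMul R I N) : f x ∈ rIdealSMul R I N' := by
  have : rIdealSMul R I N ≤ (rIdealSMul R I N').comap f.toAddMonoidHom := by
    refine (AddSubgroup.closure_le _).2 ?_
    rintro _ ⟨i, hi, n, hn, rfl⟩
    change f (i.unop • n) ∈ rIdealSMul R I N'
    rw [map_smul]
    exact smul_mem_rIdealSMul hi (h hn)
  exact this hx

theorem exists_mem_rIdealSMul_map_eq (f : B →ₗ[R] C) {N : Set B} {N' : Set C}
    (h : Set.SurjOn f N N') {x : C} (hx : x ∈ rIdealSMul R I N') :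
    ∃ y ∈ rIdealSMul R I N, f y = x := by
  have : rIdealSMul R I N' ≤ (rIdealSMul R I N).map f.toAddMonoidHom := by
    refine (AddSubgroup.closure_le _).2 ?_
    rintro _ ⟨i, hi, n, hn, rfl⟩
    obtain ⟨b, hb, rfl⟩ := h hn
    exact ⟨i.unop • b, smul_mem_rIdealSMul hi hb, map_smul f _ _⟩
  exact this hx

/-- Membership in `I • N` for the union `N` of a nonempty chain is witnessed by a member of the
chain. -/
theorem exists_mem_of_mem_rIdealSMul_sSup {c : Set (Submodule R B)} (hne : c.Nonempty)
    (hc : IsChain (· ≤ ·) c) {x : B} (hx : x ∈ rIdealSMul R I (sSup c : Submodule R B)) :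
    ∃ N ∈ c, x ∈ rIdealSMul R I (N : Set B) := by
  induction hx using AddSubgroup.closure_induction with
  | mem x hx =>
    obtain ⟨i, hi, n, hn, rfl⟩ := hx
    obtain ⟨N, hN, hnN⟩ := (Submodule.mem_sSup_of_directed hne hc.directedOn).1 hn
    exact ⟨N, hN, smul_mem_rIdealSMul hi hnN⟩
  | zero => exact hne.imp fun N hN => ⟨hN, zero_mem _⟩
  | add x y _ _ ihx ihy =>
    obtain ⟨N, hN, hx⟩ := ihx
    obtain ⟨N', hN', hy⟩ := ihy
    rcases hc.total hN hN' with h | h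
    · exact ⟨N', hN', add_mem (map_mem_rIdealSMul LinearMap.id (fun _ hz => h hz) hx) hy⟩
    · exact ⟨N, hN, add_mem hx (map_mem_rIdealSMul LinearMap.id (fun _ hz => h hz) hy)⟩
  | neg x _ ih =>
    obtain ⟨N, hN, hx⟩ := ih
    exact ⟨N, hN, neg_mem hx⟩

end RIdealSMul

section ConeatEmbedding

variable {R : Type u} [Ring R] {M N P : Type v} [AddCommGroup M] [Module R M]
  [AddCommGroup N] [Module R N] [AddCommGroup P] [Module R P]

/-- An injective homomorphism is a *coneat embedding* if its image is a coneat submodule. -/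
structure IsConeatEmbedding (f : M →ₗ[R] N) : Prop where
  injective : Function.Injective f
  mem_of_map_mem : ∀ I : Ideal Rᵐᵒᵖ, I.IsMaximal → ∀ m : M,
    f m ∈ rIdealSMul R I (Set.univ : Set N) → m ∈ rIdealSMul R I (Set.univ : Set M)

namespace IsConeatEmbedding

theorem id : IsConeatEmbedding (LinearMap.id : M →ₗ[R] M) :=
  ⟨fun _ _ h => h, fun _ _ _ h => h⟩

theorem comp {g : N →ₗ[R] P} {f : M →ₗ[R] N} (hg : IsConeatEmbedding g)
    (hf : IsConeatEmbedding f) : IsConeatEmbedding (g.comp f) :=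
  ⟨hg.injective.comp hf.injective,
    fun I hI m h => hf.mem_of_map_mem I hI m (hg.mem_of_map_mem I hI _ h)⟩

theorem of_comp {g : N →ₗ[R] P} {f : M →ₗ[R] N} (h : IsConeatEmbedding (g.comp f)) :
    IsConeatEmbedding f :=
  ⟨Function.Injective.of_comp (f := g) h.injective, fun I hI m hm =>
    h.mem_of_map_mem I hI m (map_mem_rIdealSMul g (Set.mapsTo_univ _ _) hm)⟩

theorem of_linearEquiv (e : M ≃ₗ[R] N) : IsConeatEmbedding (e : M →ₗ[R] N) := by
  refine of_comp (g := (e.symm : N →ₗ[R] M)) ?_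
  rw [LinearEquiv.symm_comp]
  exact id

theorem isConeatSubmodule_range {f : M →ₗ[R] N} (hf : IsConeatEmbedding f) :
    IsConeatSubmodule R (LinearMap.range f) := by
  rintro I hI _ ⟨m, rfl⟩ hm
  exact map_mem_rIdealSMul f (fun x _ => LinearMap.mem_range_self f x) (hf.mem_of_map_mem I hI m hm)

end IsConeatEmbedding

theorem IsConeatSubmodule.isConeatEmbedding_subtype {A : Submodule R N}
    (hA : IsConeatSubmodule R A) : IsConeatEmbedding A.subtype := by
  refine ⟨A.injective_subtype, fun I hI a ha => ?_⟩
  obtain ⟨y, hy, hya⟩ := exists_mem_rIdealSMul_map_eq A.subtype (N := Set.univ)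
    (fun x hx => ⟨⟨x, hx⟩, trivial, rfl⟩) (hA I hI a a.2 ha)
  rwa [← A.injective_subtype hya]

theorem IsConeatEmbedding.exists_extension {f : M →ₗ[R] N} (hf : IsConeatEmbedding f)
    (hP : IsConeatInjective R P) (g : M →ₗ[R] P) : ∃ h : N →ₗ[R] P, h.comp f = g := by
  let e := LinearEquiv.ofInjective f hf.injective
  obtain ⟨h, hh⟩ := hP (ModuleCat.of R N) (LinearMap.range f) hf.isConeatSubmodule_range
    (g.comp e.symm.toLinearMap)
  refine ⟨h, LinearMap.ext fun x => ?_⟩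
  have h' : h (f x) = g (e.symm (e x)) := LinearMap.congr_fun hh (e x)
  rwa [e.symm_apply_apply] at h'

theorem isConeatInjective_of_exists_extension
    (h : ∀ (A B : Type v) [AddCommGroup A] [AddCommGroup B] [Module R A] [Module R B]
      (f : A →ₗ[R] B), IsConeatEmbedding f → ∀ g : A →ₗ[R] M, ∃ k : B →ₗ[R] M, k.comp f = g) :
    IsConeatInjective R M :=
  fun _ _ hA f => h _ _ _ hA.isConeatEmbedding_subtype f

theorem IsConeatInjective.of_retract (hN : IsConeatInjective R N) (s : M →ₗ[R] N)
    (r : N →ₗ[R] M) (h : r.comp s = LinearMap.id) : IsConeatInjective R M := by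
  refine isConeatInjective_of_exists_extension fun A B _ _ _ _ f hf g => ?_
  obtain ⟨k, hk⟩ := hf.exists_extension hN (s.comp g)
  exact ⟨r.comp k, by rw [LinearMap.comp_assoc, hk, ← LinearMap.comp_assoc, h, LinearMap.id_comp]⟩

theorem IsConeatInjective.prod (hM : IsConeatInjective R M) (hN : IsConeatInjective R N) :
    IsConeatInjective R (M × N) := by
  refine isConeatInjective_of_exists_extension fun A B _ _ _ _ f hf g => ?_
  obtain ⟨k, hk⟩ := hf.exists_extension hM ((LinearMap.fst R M N).comp g)
  obtain ⟨l, hl⟩ := hf.exists_extension hN ((LinearMap.snd R M N).comp g)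
  refine ⟨k.prod l, LinearMap.ext fun x => Prod.ext ?_ ?_⟩
  · exact LinearMap.congr_fun hk x
  · exact LinearMap.congr_fun hl x

theorem IsConeatInjective.pi {ι : Type v} {T : ι → Type v} [∀ i, AddCommGroup (T i)]
    [∀ i, Module R (T i)] (hT : ∀ i, IsConeatInjective R (T i)) :
    IsConeatInjective R (∀ i, T i) := by
  refine isConeatInjective_of_exists_extension fun A B _ _ _ _ f hf g => ?_
  choose k hk using fun i => hf.exists_extension (hT i) ((LinearMap.proj i).comp g)
  exact ⟨LinearMap.pi k, LinearMap.ext fun x => funext fun i => LinearMap.congr_fun (hk i) x⟩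

theorem IsConeatInjective.of_injective [Module.Injective R M] : IsConeatInjective R M := by
  refine isConeatInjective_of_exists_extension fun A B _ _ _ _ f hf g => ?_
  obtain ⟨k, hk⟩ := Module.Injective.out f hf.injective g
  exact ⟨k, LinearMap.ext hk⟩

end ConeatEmbedding

section RightDual

variable (R : Type u) [Ring R] (I : Ideal Rᵐᵒᵖ)

/-- The character group `Hom_ℤ(R ⧸ I, ℚ ⧸ ℤ)` of the right module `R ⧸ I`, realized as the
additive maps `R → ℚ ⧸ ℤ` vanishing on `I`. -/
def rightDual : AddSubgroup (R →+ AddCircle (1 : ℚ)) where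
  carrier := {f | ∀ i ∈ I, f i.unop = 0}
  add_mem' hf hg i hi := by simp [hf i hi, hg i hi]
  zero_mem' i hi := rfl
  neg_mem' hf i hi := by simp [hf i hi]

variable {R I}

instance : SMul R (rightDual R I) where
  smul r f := ⟨f.1.comp (AddMonoidHom.mulRight r), fun i hi => by
    have := f.2 (MulOpposite.op r * i) (I.mul_mem_left _ hi)
    simpa using this⟩

@[simp]
theorem rightDual_smul_apply (r : R) (f : rightDual R I) (s : R) : (r • f).1 s = f.1 (s * r) :=
  rfl

theorem rightDual_ext {f g : rightDual R I} (h : ∀ s, f.1 s = g.1 s) : f = g :=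
  Subtype.ext (AddMonoidHom.ext h)

instance : Module R (rightDual R I) where
  one_smul f := rightDual_ext fun s => by simp
  mul_smul r r' f := rightDual_ext fun s => by simp [mul_assoc]
  smul_zero r := rfl
  smul_add r f g := rfl
  add_smul r r' f := rightDual_ext fun s => by
    change f.1 (s * (r + r')) = f.1 (s * r) + f.1 (s * r')
    rw [mul_add, map_add]
  zero_smul f := rightDual_ext fun s => by
    change f.1 (s * 0) = 0
    rw [mul_zero, map_zero]

variable {M N : Type u} [AddCommGroup M] [Module R M] [AddCommGroup N] [Module R N]

/-- Characters of `M` vanishing on `I • M` correspond to homomorphisms from `M` to the dual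
of `R ⧸ I`. -/
def toRightDual (c : M →+ AddCircle (1 : ℚ))
    (hc : ∀ x ∈ rIdealSMul R I (Set.univ : Set M), c x = 0) : M →ₗ[R] rightDual R I where
  toFun m := ⟨c.comp (AddMonoidHom.flip (smulAddHom R M) m),
    fun i hi => hc _ (smul_mem_rIdealSMul hi trivial)⟩
  map_add' m m' := rightDual_ext fun s => by
    change c (s • (m + m')) = c (s • m) + c (s • m')
    rw [smul_add, map_add]
  map_smul' r m := rightDual_ext fun s => by
    change c (s • r • m) = c ((s * r) • m)
    rw [mul_smul]

theorem toRightDual_apply (c : M →+ AddCircle (1 : ℚ))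
    (hc : ∀ x ∈ rIdealSMul R I (Set.univ : Set M), c x = 0) (m : M) (s : R) :
    (toRightDual c hc m).1 s = c (s • m) :=
  rfl

theorem rightDual_apply_one_eq_zero {f : rightDual R I}
    (hf : f ∈ rIdealSMul R I (Set.univ : Set (rightDual R I))) : f.1 1 = 0 := by
  induction hf using AddSubgroup.closure_induction with
  | mem x hx =>
    obtain ⟨i, hi, n, -, rfl⟩ := hx
    simpa using n.2 i hi
  | zero => rfl
  | add x y _ _ hx hy =>
    change x.1 1 + y.1 1 = 0
    rw [hx, hy, add_zero]
  | neg x _ hx =>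
    change -x.1 1 = 0
    rw [hx, neg_zero]

theorem IsConeatEmbedding.exists_character_extension {f : M →ₗ[R] N} (hf : IsConeatEmbedding f)
    (hI : I.IsMaximal) (c : M →+ AddCircle (1 : ℚ))
    (hc : ∀ x ∈ rIdealSMul R I (Set.univ : Set M), c x = 0) :
    ∃ d : N →+ AddCircle (1 : ℚ), (∀ x ∈ rIdealSMul R I (Set.univ : Set N), d x = 0) ∧
      ∀ m, d (f m) = c m := by
  let φ := QuotientAddGroup.map (rIdealSMul R I (Set.univ : Set M))
    (rIdealSMul R I (Set.univ : Set N)) f.toAddMonoidHom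
    (fun x hx => map_mem_rIdealSMul f (Set.mapsTo_univ _ _) hx)
  have hφ : Function.Injective φ := by
    rw [injective_iff_map_eq_zero]
    intro x
    induction x using QuotientAddGroup.induction_on with
    | H m =>
      intro hm
      have : ((f m : N) : N ⧸ rIdealSMul R I (Set.univ : Set N)) = 0 := hm
      rw [QuotientAddGroup.eq_zero_iff] at this ⊢
      exact hf.mem_of_map_mem I hI m this
  obtain ⟨d, hd⟩ := (Module.Baer.of_divisible _).extension_property_addMonoidHom φ hφ
    (QuotientAddGroup.lift _ c hc)
  refine ⟨d.comp (QuotientAddGroup.mk' _), fun x hx => ?_, fun m => ?_⟩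
  · have : (x : N ⧸ rIdealSMul R I (Set.univ : Set N)) = 0 :=
      (QuotientAddGroup.eq_zero_iff x).2 hx
    change d (x : N ⧸ rIdealSMul R I (Set.univ : Set N)) = 0
    rw [this, map_zero]
  · exact DFunLike.congr_fun hd (m : M ⧸ rIdealSMul R I (Set.univ : Set M))

theorem isConeatInjective_rightDual (hI : I.IsMaximal) :
    IsConeatInjective R (rightDual R I) := by
  refine isConeatInjective_of_exists_extension fun A B _ _ _ _ f hf g => ?_
  obtain ⟨d, hd, hdf⟩ := hf.exists_character_extension hI
    ((AddMonoidHom.eval 1).comp ((rightDual R I).subtype.comp g.toAddMonoidHom))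
    (fun x hx => rightDual_apply_one_eq_zero
      (map_mem_rIdealSMul g (Set.mapsTo_univ _ _) hx))
  refine ⟨toRightDual d hd, LinearMap.ext fun a => rightDual_ext fun s => ?_⟩
  rw [LinearMap.comp_apply, toRightDual_apply, ← map_smul, hdf]
  change (g (s • a)).1 1 = _
  rw [map_smul, rightDual_smul_apply, one_mul]

end RightDual

section EnoughConeatInjectives

variable (R : Type u) [Ring R] (M : Type u) [AddCommGroup M] [Module R M]

theorem exists_injective_linearMap_to_injective :
    ∃ (Q : ModuleCat.{u} R) (f : M →ₗ[R] Q), Module.Injective R Q ∧ Function.Injective f := by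
  obtain ⟨p⟩ := CategoryTheory.EnoughInjectives.presentation (ModuleCat.of R M)
  have := p.injective
  exact ⟨p.J, p.f.hom, Module.injective_module_of_injective_object R p.J,
    (ModuleCat.mono_iff_injective p.f).1 p.mono⟩

theorem exists_isConeatEmbedding_to_isConeatInjective :
    ∃ (G : ModuleCat.{u} R) (f : M →ₗ[R] G), IsConeatInjective R G ∧ IsConeatEmbedding f := by
  obtain ⟨Q, q, hQ, hq⟩ := exists_injective_linearMap_to_injective R M
  let ι : Type u := Σ I : {I : Ideal Rᵐᵒᵖ // I.IsMaximal},
    {c : M →+ AddCircle (1 : ℚ) // ∀ x ∈ rIdealSMul R I.1 (Set.univ : Set M), c x = 0}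
  let t : M →ₗ[R] (∀ p : ι, rightDual R p.1.1) :=
    LinearMap.pi fun p => toRightDual p.2.1 p.2.2
  refine ⟨ModuleCat.of R (Q × (∀ p : ι, rightDual R p.1.1)), q.prod t,
    IsConeatInjective.of_injective.prod
      (IsConeatInjective.pi fun p => isConeatInjective_rightDual p.1.2), ?_, ?_⟩
  · exact fun x y h => hq (congrArg Prod.fst h)
  · intro I hI m hm
    rw [← QuotientAddGroup.eq_zero_iff]
    refine CharacterModule.eq_zero_of_character_apply fun c => ?_
    let d : M →+ AddCircle (1 : ℚ) :=
      AddMonoidHom.comp c (QuotientAddGroup.mk' (rIdealSMul R I (Set.univ : Set M)))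
    have hd : ∀ x ∈ rIdealSMul R I (Set.univ : Set M), d x = 0 := fun x hx => by
      change c (x : M ⧸ rIdealSMul R I (Set.univ : Set M)) = 0
      rw [(QuotientAddGroup.eq_zero_iff x).2 hx]
      exact map_zero c
    have h := map_mem_rIdealSMul ((LinearMap.proj (⟨⟨I, hI⟩, ⟨d, hd⟩⟩ : ι)).comp
      (LinearMap.snd R Q (∀ p : ι, rightDual R p.1.1))) (Set.mapsTo_univ _ Set.univ) hm
    have h1 := rightDual_apply_one_eq_zero h
    change d ((1 : R) • m) = 0 at h1
    rwa [one_smul] at h1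

end EnoughConeatInjectives

section ConeatEssential

variable {R : Type u} [Ring R] {M N P : Type u} [AddCommGroup M] [Module R M]
  [AddCommGroup N] [Module R N] [AddCommGroup P] [Module R P]

/-- A coneat embedding `f` is *coneat-essential* if every homomorphism `g` for which `g ∘ f` is a
coneat embedding is injective. -/
structure IsConeatEssential (f : M →ₗ[R] N) : Prop extends IsConeatEmbedding f where
  injective_of_comp : ∀ (X : Type u) [AddCommGroup X] [Module R X] (g : N →ₗ[R] X),
    IsConeatEmbedding (g.comp f) → Function.Injective g

theorem IsConeatEssential.linearEquiv_comp {f : M →ₗ[R] N} (hf : IsConeatEssential f)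
    (e : N ≃ₗ[R] P) : IsConeatEssential (e.toLinearMap.comp f) where
  toIsConeatEmbedding := (IsConeatEmbedding.of_linearEquiv e).comp hf.toIsConeatEmbedding
  injective_of_comp X _ _ g hg := by
    have := (hf.injective_of_comp X (g.comp e.toLinearMap) hg).comp e.symm.injective
    convert this using 1
    ext x
    simp

theorem isConeatEssential_linearEquiv (e : M ≃ₗ[R] N) : IsConeatEssential e.toLinearMap := by
  have h : IsConeatEssential (LinearMap.id : M →ₗ[R] M) :=
    ⟨.id, fun X _ _ g hg => hg.injective⟩
  exact h.linearEquiv_comp e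

/-- Every coneat embedding becomes coneat-essential after passing to a suitable quotient of the
codomain. -/
theorem IsConeatEmbedding.exists_isConeatEssential_mkQ_comp {f : M →ₗ[R] N}
    (hf : IsConeatEmbedding f) : ∃ K : Submodule R N, IsConeatEssential (K.mkQ.comp f) := by
  have lift_mem : ∀ (K : Submodule R N) (I : Ideal Rᵐᵒᵖ) (m : M),
      K.mkQ (f m) ∈ rIdealSMul R I (Set.univ : Set (N ⧸ K)) →
      ∃ y ∈ rIdealSMul R I (Set.univ : Set N), y - f m ∈ K := by
    intro K I m hm
    obtain ⟨y, hy, hym⟩ := exists_mem_rIdealSMul_map_eq K.mkQ (N := Set.univ)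
      (fun x _ => by simpa using K.mkQ_surjective x) hm
    exact ⟨y, hy, (Submodule.Quotient.eq K).1 hym⟩
  obtain ⟨K, -, hK⟩ := zorn_le_nonempty₀ {K : Submodule R N | IsConeatEmbedding (K.mkQ.comp f)}
    (fun c hcs hc K₀ hK₀ => by
      have hne : c.Nonempty := ⟨K₀, hK₀⟩
      refine ⟨sSup c, ⟨?_, fun I hI m hm => ?_⟩, fun K hK => le_sSup hK⟩
      · rw [injective_iff_map_eq_zero]
        intro m hm
        obtain ⟨K, hK, hmK⟩ := (Submodule.mem_sSup_of_directed hne hc.directedOn).1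
          ((Submodule.Quotient.mk_eq_zero _).1 hm)
        exact (injective_iff_map_eq_zero _).1 (hcs hK).injective m
          ((Submodule.Quotient.mk_eq_zero _).2 hmK)
      · obtain ⟨y, hy, hym⟩ := lift_mem _ I m hm
        obtain ⟨K, hK, hmK⟩ := (Submodule.mem_sSup_of_directed hne hc.directedOn).1 hym
        refine (hcs hK).mem_of_map_mem I hI m ?_
        have : K.mkQ.comp f m = K.mkQ y := ((Submodule.Quotient.eq K).2 hmK).symm
        rw [this]
        exact map_mem_rIdealSMul K.mkQ (Set.mapsTo_univ _ _) hy)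
    ⊥ (by
      refine IsConeatEmbedding.comp ?_ hf
      exact IsConeatEmbedding.of_linearEquiv
        (Submodule.quotEquivOfEqBot (⊥ : Submodule R N) rfl).symm)
  refine ⟨K, hK.prop, fun X _ _ g hg => ?_⟩
  have hle : K ≤ LinearMap.ker (g.comp K.mkQ) := fun x hx => by
    have : K.mkQ x = 0 := (Submodule.Quotient.mk_eq_zero _).2 hx
    simp [this]
  have hmem : IsConeatEmbedding ((LinearMap.ker (g.comp K.mkQ)).mkQ.comp f) := by
    refine IsConeatEmbedding.of_comp
      (g := (LinearMap.ker (g.comp K.mkQ)).liftQ (g.comp K.mkQ) le_rfl) ?_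
    rwa [← LinearMap.comp_assoc, Submodule.liftQ_mkQ, LinearMap.comp_assoc]
  have hge := hK.le_of_ge hmem hle
  rw [injective_iff_map_eq_zero]
  intro x hx
  obtain ⟨y, rfl⟩ := K.mkQ_surjective x
  exact (Submodule.Quotient.mk_eq_zero _).2 (hge hx)

/-- Among the submodules of `Q` that are coneat-essential extensions of a given embedded module
there is a maximal one. -/
theorem exists_maximal_isConeatEssential_submodule {m : M →ₗ[R] N} (hm : Function.Injective m) :
    ∃ L : Submodule R N, Maximal (fun L : Submodule R N => ∃ h : ∀ x, m x ∈ L,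
      IsConeatEssential (m.codRestrict L h)) L := by
  obtain ⟨L, -, hL⟩ := zorn_le_nonempty₀ {L : Submodule R N | ∃ h : ∀ x, m x ∈ L,
      IsConeatEssential (m.codRestrict L h)}
    (fun c hcs hc L₀ hL₀ => by
      have hne : c.Nonempty := ⟨L₀, hL₀⟩
      have hmem : ∀ x, m x ∈ sSup c := fun x => le_sSup hL₀ ((hcs hL₀).1 x)
      refine ⟨sSup c, ⟨hmem, ⟨fun x y h => hm (congrArg Subtype.val h), fun I hI x hx => ?_⟩,
        fun X _ _ g hg => ?_⟩, fun L hL => le_sSup hL⟩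
      · have h1 : m x ∈ rIdealSMul R I (sSup c : Submodule R N) :=
          map_mem_rIdealSMul (sSup c).subtype (fun y _ => y.2) hx
        obtain ⟨L, hL, hxL⟩ := exists_mem_of_mem_rIdealSMul_sSup hne hc h1
        obtain ⟨h, hess⟩ := hcs hL
        refine hess.mem_of_map_mem I hI x ?_
        obtain ⟨y, hy, hyx⟩ := exists_mem_rIdealSMul_map_eq L.subtype (N := Set.univ)
          (fun z hz => ⟨⟨z, hz⟩, trivial, rfl⟩) hxL
        rwa [show m.codRestrict L h x = y from Subtype.ext hyx.symm]
      · rw [injective_iff_map_eq_zero]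
        rintro ⟨y, hy⟩ hgy
        obtain ⟨L, hL, hyL⟩ := (Submodule.mem_sSup_of_directed hne hc.directedOn).1 hy
        obtain ⟨h, hess⟩ := hcs hL
        have hinj := hess.injective_of_comp X
          (g.comp (Submodule.inclusion (le_sSup hL))) hg
        have := (injective_iff_map_eq_zero _).1 hinj ⟨y, hyL⟩ hgy
        exact Subtype.ext (show y = 0 from congrArg Subtype.val this))
    (LinearMap.range m) ⟨LinearMap.mem_range_self m, by
      exact isConeatEssential_linearEquiv (LinearEquiv.ofInjective m hm)⟩
  exact ⟨L, hL⟩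

/-- Every module has a coneat-essential extension which admits no proper coneat-essential
extension over the given module. -/
theorem exists_isConeatEssential_forall_bijective (R : Type u) [Ring R] (M : Type u)
    [AddCommGroup M] [Module R M] :
    ∃ (E : ModuleCat.{u} R) (j : M →ₗ[R] E), IsConeatEssential j ∧
      ∀ (E' : Type u) [AddCommGroup E'] [Module R E'] (u : E →ₗ[R] E'),
        IsConeatEssential (u.comp j) → Function.Bijective u := by
  classical
  obtain ⟨G, i, hG, hi⟩ := exists_isConeatEmbedding_to_isConeatInjective R M
  obtain ⟨Q₀, ι, hQ₀, hι⟩ :=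
    exists_injective_linearMap_to_injective R (∀ L : Submodule R G, G ⧸ L)
  let m : M →ₗ[R] (Set G → Q₀) := LinearMap.pi fun _ =>
    ι.comp ((LinearMap.pi fun L : Submodule R G => L.mkQ).comp i)
  have hm : Function.Injective m := by
    rw [injective_iff_map_eq_zero]
    intro x hx
    have h1 : (⊥ : Submodule R G).mkQ (i x) = 0 :=
      congrFun ((injective_iff_map_eq_zero ι).1 hι _ (congrFun hx ∅)) ⊥
    have h2 : i x = 0 := by simpa using (Submodule.Quotient.mk_eq_zero _).1 h1
    exact (injective_iff_map_eq_zero i).1 hi.injective x h2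
  obtain ⟨C, ⟨hmC, hC⟩, hmax⟩ := exists_maximal_isConeatEssential_submodule hm
  refine ⟨ModuleCat.of R C, m.codRestrict C hmC, hC, fun E' _ _ u hu => ?_⟩
  have hu_inj : Function.Injective u := hC.injective_of_comp E' u hu.toIsConeatEmbedding
  refine ⟨hu_inj, fun y => ?_⟩
  obtain ⟨θ, hθ⟩ := hu.exists_extension hG i
  have hθ_inj : Function.Injective θ := hu.injective_of_comp G θ (hθ ▸ hi)
  obtain ⟨φ, hφ⟩ := Module.Injective.out (Q := Set G → Q₀) u hu_inj C.subtype
  let L : Submodule R G := LinearMap.range (θ.comp u)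
  let ψ : E' →ₗ[R] Q₀ := ι.comp ((LinearMap.single R (fun L : Submodule R G => G ⧸ L) L).comp
    (L.mkQ.comp θ))
  have hψ : ∀ x, ψ x = 0 ↔ ∃ z, u z = x := by
    intro x
    rw [← map_zero ι, ← map_zero (LinearMap.single R (fun L : Submodule R G => G ⧸ L) L)]
    change ι _ = ι _ ↔ _
    rw [hι.eq_iff, LinearMap.comp_apply, LinearMap.coe_single,
      (Pi.single_injective (M := fun L : Submodule R G => G ⧸ L) L).eq_iff]
    change L.mkQ (θ x) = 0 ↔ _
    rw [Submodule.mkQ_apply, Submodule.Quotient.mk_eq_zero]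
    exact ⟨fun ⟨z, hz⟩ => ⟨z, hθ_inj hz⟩, fun ⟨z, hz⟩ => ⟨z, by simp [hz]⟩⟩
  obtain ⟨s, hs⟩ : ∃ s : Set G, ∀ (x : E') (q : Q₀), φ x = Pi.single s q → φ x = 0 := by
    by_contra! hcon
    choose x q hxq hx0 using hcon
    have hinj : Function.Injective x := by
      intro s t hst
      by_contra hne
      apply hx0 s
      have h1 : φ (x s) s = 0 := by
        rw [hst, hxq t, Pi.single_eq_of_ne hne]
      rw [hxq s, Pi.single_eq_same] at h1
      rw [hxq s, h1, Pi.single_zero]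
    exact Function.cantor_injective _ (hθ_inj.comp hinj)
  let Φ : E' →ₗ[R] (Set G → Q₀) :=
    φ + (LinearMap.single R (fun _ : Set G => (Q₀ : Type u)) s).comp ψ
  have hΦu : ∀ z, Φ (u z) = z := by
    intro z
    have h1 : ψ (u z) = 0 := (hψ _).2 ⟨z, rfl⟩
    change φ (u z) + (Pi.single s (ψ (u z)) : Set G → Q₀) = z
    rw [h1, hφ, Pi.single_zero, add_zero]
    rfl
  have hΦ : Function.Injective Φ := by
    rw [injective_iff_map_eq_zero]
    intro x hx
    have h1 : φ x + (Pi.single s (ψ x) : Set G → Q₀) = 0 := hx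
    have h2 : φ x = 0 := by
      refine hs x (-ψ x) ?_
      rw [Pi.single_neg]
      exact eq_neg_of_add_eq_zero_left h1
    rw [h2, zero_add, Pi.single_eq_zero_iff] at h1
    obtain ⟨z, rfl⟩ := (hψ x).1 h1
    have h3 := hΦu z
    rw [hx] at h3
    rw [show z = 0 from Subtype.ext h3.symm, map_zero]
  have hmem : ∃ h : ∀ x, m x ∈ LinearMap.range Φ,
      IsConeatEssential (m.codRestrict (LinearMap.range Φ) h) := by
    have h : ∀ x, Φ (u (m.codRestrict C hmC x)) = m x := fun x => hΦu _
    refine ⟨fun x => ⟨_, h x⟩, ?_⟩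
    convert hu.linearEquiv_comp (LinearEquiv.ofInjective Φ hΦ) using 1
    ext1 x
    exact Subtype.ext (h x).symm
  have hle : C ≤ LinearMap.range Φ := fun z hz => ⟨u ⟨z, hz⟩, hΦu _⟩
  have hy : Φ y ∈ C := hmax hmem hle ⟨y, rfl⟩
  exact ⟨⟨Φ y, hy⟩, hΦ (hΦu _)⟩

theorem exists_isConeatInjectiveEnvelope (R : Type u) [Ring R] (M : Type u)
    [AddCommGroup M] [Module R M] :
    ∃ (E : ModuleCat.{u} R) (e : M →ₗ[R] E), IsConeatInjectiveEnvelope R e := by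
  obtain ⟨E, j, hj, hE⟩ := exists_isConeatEssential_forall_bijective R M
  obtain ⟨H, k, hH, hk⟩ := exists_isConeatEmbedding_to_isConeatInjective R E
  obtain ⟨K, hK⟩ := (hk.comp hj.toIsConeatEmbedding).exists_isConeatEssential_mkQ_comp
  let e := LinearEquiv.ofBijective (K.mkQ.comp k) (hE _ (K.mkQ.comp k) hK)
  refine ⟨E, j, hj.injective, ?_, fun C hC g => hj.exists_extension hC g, fun f hf => ?_⟩
  · exact hH.of_retract k (e.symm.toLinearMap.comp K.mkQ)
      (LinearMap.ext fun x => e.symm_apply_apply x)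
  · exact hE E f (by rwa [hf])

end ConeatEssential

section SplittingCriteria

variable {R : Type u} [Ring R]

theorem IsConeatSubmodule.exists_retraction_of_forall_split
    (h : ∀ (A B C : ModuleCat.{u} R) (f : A →ₗ[R] B) (g : B →ₗ[R] C),
      IsConeatExactSeq R f g → ∃ r : B →ₗ[R] A, r.comp f = LinearMap.id)
    {B : Type u} [AddCommGroup B] [Module R B] {A : Submodule R B} (hA : IsConeatSubmodule R A) :
    ∃ r : B →ₗ[R] A, r.comp A.subtype = LinearMap.id :=
  h (ModuleCat.of R A) (ModuleCat.of R B) (ModuleCat.of R (B ⧸ A)) A.subtype A.mkQ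
    ⟨A.injective_subtype, A.mkQ_surjective, LinearMap.exact_subtype_mkQ A, by
      rwa [Submodule.range_subtype]⟩

theorem forall_split_iff_forall_isConeatInjective :
    (∀ (A B C : ModuleCat.{u} R) (f : A →ₗ[R] B) (g : B →ₗ[R] C),
        IsConeatExactSeq R f g → ∃ r : B →ₗ[R] A, r.comp f = LinearMap.id) ↔
      ∀ M : ModuleCat.{u} R, IsConeatInjective R M := by
  refine ⟨fun h M B A hA f => ?_, fun h A B C f g hfg => ?_⟩
  · obtain ⟨r, hr⟩ := hA.exists_retraction_of_forall_split h
    exact ⟨f.comp r, by rw [LinearMap.comp_assoc, hr, LinearMap.comp_id]⟩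
  · let e := LinearEquiv.ofInjective f hfg.1
    obtain ⟨r, hr⟩ := h A B (LinearMap.range f) hfg.2.2.2 e.symm.toLinearMap
    refine ⟨r, LinearMap.ext fun x => ?_⟩
    have hx : r (f x) = e.symm (e x) := LinearMap.congr_fun hr (e x)
    rw [LinearMap.comp_apply, hx, e.symm_apply_apply, LinearMap.id_apply]

theorem IsConeatInjective.isConeatQuasiInjective {M : Type u} [AddCommGroup M] [Module R M]
    (hM : IsConeatInjective R M) : IsConeatQuasiInjective R M := by
  intro E e he f n
  obtain ⟨h, hh⟩ := he.2.2.1 (ModuleCat.of R M) hM LinearMap.id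
  have hbij := he.2.2.2 (e.comp h) (by rw [LinearMap.comp_assoc, hh, LinearMap.comp_id])
  obtain ⟨y, hy⟩ := hbij.2 (f n)
  exact ⟨h y, hy⟩

/-- If `e : M → E` is a coneat injective envelope, then so is `M × E → E × E`. -/
theorem IsConeatInjectiveEnvelope.prodMap_id {M E : Type u} [AddCommGroup M] [Module R M]
    [AddCommGroup E] [Module R E] {e : M →ₗ[R] E} (he : IsConeatInjectiveEnvelope R e) :
    IsConeatInjectiveEnvelope R (e.prodMap (LinearMap.id : E →ₗ[R] E)) := by
  obtain ⟨hinj, hE, hext, hauto⟩ := he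
  refine ⟨?_, hE.prod hE, fun C hC g => ?_, fun f hf => ?_⟩
  · exact hinj.prodMap Function.injective_id
  · obtain ⟨h, hh⟩ := hext C hC (g.comp (LinearMap.inl R M E))
    refine ⟨h.coprod (g.comp (LinearMap.inr R M E)), ?_⟩
    ext x
    · simpa [← Prod.zero_eq_mk] using LinearMap.congr_fun hh x
    · simp
  · have hf' : ∀ m x, f (e m, x) = (e m, x) := fun m x => LinearMap.congr_fun hf (m, x)
    have hsnd : ∀ x, f (0, x) = (0, x) := fun x => by simpa using hf' 0 x
    have hfst : ∀ y x, f (y, x) = f (y, 0) + (0, x) := fun y x => by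
      rw [← hsnd x, ← map_add]
      simp
    let a : E →ₗ[R] E := (LinearMap.fst R E E).comp (f.comp (LinearMap.inl R E E))
    have ha : Function.Bijective a := hauto a (LinearMap.ext fun m =>
      congrArg Prod.fst (hf' m 0))
    have hfa : ∀ y x, f (y, x) = (a y, (f (y, 0)).2 + x) := fun y x => by
      rw [hfst]
      ext
      · simp [a]
      · simp
    refine ⟨?_, ?_⟩
    · rintro ⟨y, x⟩ ⟨y', x'⟩ h
      rw [hfa, hfa y', Prod.mk.injEq] at h
      obtain rfl := ha.1 h.1
      rw [add_left_cancel h.2]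
    · rintro ⟨y, x⟩
      obtain ⟨y, rfl⟩ := ha.2 y
      exact ⟨(y, x - (f (y, 0)).2), by rw [hfa]; simp⟩

theorem forall_isConeatInjective_iff_forall_isConeatQuasiInjective :
    (∀ M : ModuleCat.{u} R, IsConeatInjective R M) ↔
      ∀ M : ModuleCat.{u} R, IsConeatQuasiInjective R M := by
  refine ⟨fun h M => (h M).isConeatQuasiInjective, fun h M => ?_⟩
  obtain ⟨E, e, he⟩ := exists_isConeatInjectiveEnvelope R M
  have hsurj : Function.Surjective e := fun x => by
    obtain ⟨⟨m, y⟩, hm⟩ := h (ModuleCat.of R (M × E)) (ModuleCat.of R (E × E)) _ he.prodMap_id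
      ((LinearMap.inl R E E).comp (LinearMap.snd R M E)) (0, x)
    exact ⟨m, congrArg Prod.fst hm⟩
  let e' := LinearEquiv.ofBijective e ⟨he.1, hsurj⟩
  exact he.2.1.of_retract e e'.symm.toLinearMap (LinearMap.ext fun x => e'.symm_apply_apply x)

theorem forall_isConeatInjective_iff_forall_isQuasiConeatInjective :
    (∀ M : ModuleCat.{u} R, IsConeatInjective R M) ↔
      ∀ M : ModuleCat.{u} R, IsQuasiConeatInjective R M := by
  refine ⟨fun h M K hK f => h M M K hK f, fun h M => ?_⟩
  obtain ⟨G, i, hG, hi⟩ := exists_isConeatEmbedding_to_isConeatInjective R M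
  have hinr : IsConeatEmbedding (LinearMap.inr R M G) :=
    IsConeatEmbedding.of_comp (g := LinearMap.snd R M G) (by
      rw [LinearMap.snd_comp_inr]
      exact .id)
  have hemb := hinr.comp hi
  let k := (LinearMap.inr R M G).comp i
  let e := LinearEquiv.ofInjective k hemb.injective
  obtain ⟨g, hg⟩ := h (ModuleCat.of R (M × G)) (LinearMap.range k) hemb.isConeatSubmodule_range
    ((LinearMap.inl R M G).comp e.symm.toLinearMap)
  refine hG.of_retract i ((LinearMap.fst R M G).comp (g.comp (LinearMap.inr R M G)))
    (LinearMap.ext fun x => ?_)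
  have hx : g (k x) = (e.symm (e x), 0) := LinearMap.congr_fun hg (e x)
  rw [e.symm_apply_apply] at hx
  exact congrArg Prod.fst hx

end SplittingCriteria

section SFRing

variable {R : Type u} [Ring R]

/-- Projective right modules are flat. -/
theorem isFlatRightModule_of_projective (S : Type v) [AddCommGroup S] [Module Rᵐᵒᵖ S]
    [Module.Projective Rᵐᵒᵖ S] : IsFlatRightModule R S := by
  classical
  intro m a s hs
  obtain ⟨σ, hσ⟩ := Module.projective_def'.1 (inferInstance : Module.Projective Rᵐᵒᵖ S)
  let F : Finset S := Finset.univ.biUnion fun i => (σ (s i)).support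
  let x : Fin F.card → S := fun j => F.equivFin.symm j
  refine ⟨F.card, fun j i => (σ (s i) (x j)).unop, x, fun i => ?_, fun j => ?_⟩
  · have h1 : Finsupp.linearCombination Rᵐᵒᵖ id (σ (s i)) = s i := LinearMap.congr_fun hσ (s i)
    have h2 : (σ (s i)).support ⊆ F := Finset.subset_biUnion_of_mem (fun i => (σ (s i)).support)
      (Finset.mem_univ i)
    rw [Finsupp.linearCombination_apply, Finsupp.sum_of_support_subset _ h2 _ (by simp)] at h1
    conv_lhs => rw [← h1]
    rw [← Finset.sum_coe_sort F, ← F.equivFin.symm.sum_comp]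
    simp [x]
  · have h1 := DFunLike.congr_fun (congrArg σ hs) (x j)
    rw [map_sum, Finsupp.finsetSum_apply, map_zero] at h1
    simpa using congrArg MulOpposite.unop h1

/-- If `R ⧸ I` is flat then every element `i` of the right ideal `I` has a left unit in `I`. -/
theorem exists_mem_mul_eq_of_isFlatRightModule {I : Ideal Rᵐᵒᵖ}
    (h : IsFlatRightModule R (Rᵐᵒᵖ ⧸ I)) {i : Rᵐᵒᵖ} (hi : i ∈ I) :
    ∃ e ∈ I, e.unop * i.unop = i.unop := by
  obtain ⟨n, b, t, h1, h2⟩ := h 1 (fun _ => i.unop) (fun _ => Submodule.Quotient.mk 1) (by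
    rw [Fin.sum_univ_one, ← Submodule.Quotient.mk_smul, Submodule.Quotient.mk_eq_zero]
    simpa using hi)
  choose r hr using fun j => Submodule.Quotient.mk_surjective I (t j)
  have h3 : (1 : Rᵐᵒᵖ) - ∑ j, MulOpposite.op (b j 0) * r j ∈ I := by
    rw [← Submodule.Quotient.eq, h1 0, ← Submodule.mkQ_apply, map_sum]
    refine Finset.sum_congr rfl fun j _ => ?_
    rw [← hr j, ← Submodule.Quotient.mk_smul]
    rfl
  refine ⟨_, h3, ?_⟩
  have h4 : ∀ j, b j 0 * i.unop = 0 := fun j => by simpa using h2 j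
  simp [sub_mul, Finset.sum_mul, mul_assoc, h4]

/-- If `R ⧸ I` is flat then every element `x` of `I • B` satisfies `x = e • x` for some `e ∈ I`. -/
theorem exists_mem_smul_eq_of_isFlatRightModule {I : Ideal Rᵐᵒᵖ}
    (h : IsFlatRightModule R (Rᵐᵒᵖ ⧸ I)) {B : Type v} [AddCommGroup B] [Module R B] {x : B}
    (hx : x ∈ rIdealSMul R I (Set.univ : Set B)) : ∃ e ∈ I, e.unop • x = x := by
  -- `e'` can be chosen so that every element fixed by a prescribed `e ∈ I` is fixed by `e'`.
  suffices key : ∀ e ∈ I, ∃ e' ∈ I, e'.unop • x = x ∧ ∃ c : R, 1 - e'.unop = c * (1 - e.unop) by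
    obtain ⟨e, he, hex, -⟩ := key 0 I.zero_mem
    exact ⟨e, he, hex⟩
  have fixed : ∀ {e e' : Rᵐᵒᵖ} {c : R} {y : B}, 1 - e'.unop = c * (1 - e.unop) →
      e.unop • y = y → e'.unop • y = y := by
    intro e e' c y hc hy
    have : (1 - e'.unop) • y = 0 := by rw [hc, mul_smul, sub_smul, one_smul, hy, sub_self, smul_zero]
    rw [sub_smul, one_smul, sub_eq_zero] at this
    exact this.symm
  induction hx using AddSubgroup.closure_induction with
  | mem x hx =>
    obtain ⟨i, hi, n, -, rfl⟩ := hx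
    intro e he
    obtain ⟨d, hd, hdi⟩ := exists_mem_mul_eq_of_isFlatRightModule h
      (I.sub_mem hi (I.mul_mem_left i he))
    refine ⟨d + e - e * d, I.sub_mem (I.add_mem hd he) (I.mul_mem_left e hd), ?_,
      1 - d.unop, ?_⟩
    · rw [← mul_smul]
      congr 1
      simp only [MulOpposite.unop_sub, MulOpposite.unop_mul, mul_sub] at hdi
      simp only [MulOpposite.unop_sub, MulOpposite.unop_add, MulOpposite.unop_mul, sub_mul,
        add_mul, mul_assoc]
      rw [add_sub_right_comm, hdi, sub_add_cancel]
    · simp only [MulOpposite.unop_sub, MulOpposite.unop_add, MulOpposite.unop_mul]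
      noncomm_ring
  | zero => exact fun e he => ⟨e, he, smul_zero _, 1, (one_mul _).symm⟩
  | add x y _ _ ihx ihy =>
    intro e he
    obtain ⟨e₁, he₁, hx, c₁, hc₁⟩ := ihx e he
    obtain ⟨e₂, he₂, hy, c₂, hc₂⟩ := ihy e₁ he₁
    exact ⟨e₂, he₂, by rw [smul_add, fixed hc₂ hx, hy], c₂ * c₁, by rw [hc₂, hc₁, mul_assoc]⟩
  | neg x _ ih =>
    intro e he
    obtain ⟨e', he', hx, hc⟩ := ih e he
    exact ⟨e', he', by rw [smul_neg, hx], hc⟩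

theorem isConeatSubmodule_of_forall_simple_isFlat
    (h : ∀ S : ModuleCat.{u} Rᵐᵒᵖ, IsSimpleModule Rᵐᵒᵖ S → IsFlatRightModule R S)
    {B : Type v} [AddCommGroup B] [Module R B] (A : Submodule R B) : IsConeatSubmodule R A := by
  intro I hI a ha haI
  obtain ⟨e, he, hea⟩ := exists_mem_smul_eq_of_isFlatRightModule
    (h (ModuleCat.of Rᵐᵒᵖ (Rᵐᵒᵖ ⧸ I)) (isSimpleModule_iff_isCoatom.2 hI.out)) haI
  rw [← hea]
  exact smul_mem_rIdealSMul he ha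

theorem isSemisimpleRing_iff_isFlat_and_split :
    IsSemisimpleRing R ↔
      ((∀ S : ModuleCat.{u} Rᵐᵒᵖ, IsSimpleModule Rᵐᵒᵖ S → IsFlatRightModule R S) ∧
        (∀ (A B C : ModuleCat.{u} R) (f : A →ₗ[R] B) (g : B →ₗ[R] C),
          IsConeatExactSeq R f g → ∃ r : B →ₗ[R] A, r.comp f = LinearMap.id)) := by
  refine ⟨fun _ => ⟨fun S _ => ?_, fun A B C f g hfg => ?_⟩, fun ⟨hflat, hsplit⟩ => ?_⟩
  · have := Module.projective_of_isSemisimpleRing Rᵐᵒᵖ S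
    exact isFlatRightModule_of_projective S
  · have := Module.injective_of_isSemisimpleRing R A
    obtain ⟨r, hr⟩ := Module.Injective.out f hfg.1 (LinearMap.id : A →ₗ[R] A)
    exact ⟨r, LinearMap.ext hr⟩
  · refine (isSemisimpleModule_iff R R).2 ⟨fun A => ?_⟩
    obtain ⟨r, hr⟩ := (isConeatSubmodule_of_forall_simple_isFlat hflat
      A).exists_retraction_of_forall_split hsplit
    exact ⟨_, LinearMap.isCompl_of_proj (f := r) fun x => LinearMap.congr_fun hr x⟩

end SFRing

/-- The following are equivalent for a ring `R`: (1) every coneat exact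
sequence of left `R`-modules splits; (2) every left `R`-module is coneat injective; (3) every
left `R`-module is coneat quasi injective; (4) every left `R`-module is quasi coneat
injective. Furthermore, `R` is semisimple artinian if and only if `R` is a right SF-ring and
every coneat exact sequence of left `R`-modules splits. -/
theorem coneat_split_ring_tfae (R : Type u) [Ring R] :
    (((∀ (A B C : ModuleCat.{u} R) (f : A →ₗ[R] B) (g : B →ₗ[R] C),
        IsConeatExactSeq R f g → ∃ r : B →ₗ[R] A, r.comp f = LinearMap.id) ↔
      (∀ M : ModuleCat.{u} R, IsConeatInjective R M)) ∧
      ((∀ M : ModuleCat.{u} R, IsConeatInjective R M) ↔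
        (∀ M : ModuleCat.{u} R, IsConeatQuasiInjective R M)) ∧
      ((∀ M : ModuleCat.{u} R, IsConeatQuasiInjective R M) ↔
        (∀ M : ModuleCat.{u} R, IsQuasiConeatInjective R M))) ∧
    (IsSemisimpleRing R ↔
      ((∀ S : ModuleCat.{u} Rᵐᵒᵖ, IsSimpleModule Rᵐᵒᵖ S → IsFlatRightModule R S) ∧
        (∀ (A B C : ModuleCat.{u} R) (f : A →ₗ[R] B) (g : B →ₗ[R] C),
          IsConeatExactSeq R f g → ∃ r : B →ₗ[R] A, r.comp f = LinearMap.id))) :=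
  ⟨⟨forall_split_iff_forall_isConeatInjective,
    forall_isConeatInjective_iff_forall_isConeatQuasiInjective,
    forall_isConeatInjective_iff_forall_isConeatQuasiInjective.symm.trans
      forall_isConeatInjective_iff_forall_isQuasiConeatInjective⟩,
    isSemisimpleRing_iff_isFlat_and_split⟩
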